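/- arXiv:math/0502121 — 2 statements merged into one kernel-verified Lean document; each statement's English description precedes it below -/
import Mathlib

section
/- Let (J, Γ) be in standard form at 0 ∈ ℂⁿ. Then the Levi forms of Γ at 0 with respect to J and with respect to J_st coincide: L(v) = L_st(v) for every v ∈ D₀ = ℂ^{n−1}×{0}. In particular, Γ is strongly pseudoconvex at 0 with respect to J if and only if it is strongly pseudoconvex at 0 with respect to J_st. -/
open Complex ComplexConjugate Finset Asymptotics

noncomputable section

/-- Standard complex structure of `ℂⁿ`: multiplication by `i`. -/
def Jstd (n : ℕ) : (Fin n → ℂ) →L[ℝ] (Fin n → ℂ) :=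
  Complex.I • ContinuousLinearMap.id ℝ (Fin n → ℂ)

/-- The 1-form `θ := dρ ∘ J`. -/
def theta (n : ℕ) (ρ : (Fin n → ℂ) → ℝ)
    (J : (Fin n → ℂ) → ((Fin n → ℂ) →L[ℝ] (Fin n → ℂ)))
    (z : Fin n → ℂ) : (Fin n → ℂ) →L[ℝ] ℝ :=
  (fderiv ℝ ρ z).comp (J z)

/-- Exterior derivative of the 1-form `θ`. -/
def dtheta (n : ℕ) (ρ : (Fin n → ℂ) → ℝ)
    (J : (Fin n → ℂ) → ((Fin n → ℂ) →L[ℝ] (Fin n → ℂ)))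
    (z u w : Fin n → ℂ) : ℝ :=
  fderiv ℝ (theta n ρ J) z u w - fderiv ℝ (theta n ρ J) z w u

/-- Levi form of `{ρ = 0}` at `x` with respect to `J`: `L(v) = −dθ_x(v, J_x v)`. -/
def levi (n : ℕ) (ρ : (Fin n → ℂ) → ℝ)
    (J : (Fin n → ℂ) → ((Fin n → ℂ) →L[ℝ] (Fin n → ℂ)))
    (x v : Fin n → ℂ) : ℝ :=
  - dtheta n ρ J x v (J x v)

/-- A function agreeing with `2 Re zⁿ − Σ |z^α|²` to third order has differential `2 Re dzⁿ` at `0`. -/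
lemma fderiv_zero_of_standard_form (n : ℕ) (ρ : (Fin (n+1) → ℂ) → ℝ)
    (hρform : (fun z : Fin (n+1) → ℂ =>
        ρ z - (2 * (z (Fin.last n)).re - ∑ α : Fin n, Complex.normSq (z α.castSucc)))
      =O[nhds 0] fun z : Fin (n+1) → ℂ => ‖z‖ ^ 3)
    (h : Fin (n+1) → ℂ) :
    fderiv ℝ ρ 0 h = 2 * (h (Fin.last n)).re := by
  have hrem := IsBigO.hasFDerivAt (𝕜 := ℝ) (x₀ := (0 : Fin (n+1) → ℂ)) (n := 3)
    (by simpa using hρform) (by norm_num)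
  have hsq : HasFDerivAt (fun z : Fin (n+1) → ℂ => ∑ α : Fin n, Complex.normSq (z α.castSucc))
      (0 : (Fin (n+1) → ℂ) →L[ℝ] ℝ) 0 := by
    refine IsBigO.hasFDerivAt (n := 2) (IsBigO.fun_sum fun α _ => ?_) (by norm_num)
    refine IsBigO.of_bound 1 (Filter.Eventually.of_forall fun z => ?_)
    rw [Complex.normSq_eq_norm_sq]
    simpa using pow_le_pow_left₀ (norm_nonneg _) (norm_le_pi_norm z α.castSucc) 2
  have hlin : HasFDerivAt (fun z : Fin (n+1) → ℂ => 2 * (z (Fin.last n)).re)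
      ((2 : ℝ) • Complex.reCLM.comp
        (ContinuousLinearMap.proj (R := ℝ) (φ := fun _ : Fin (n+1) => ℂ) (Fin.last n))) 0 :=
    ((2 : ℝ) • Complex.reCLM.comp
        (ContinuousLinearMap.proj (R := ℝ) (φ := fun _ : Fin (n+1) => ℂ) (Fin.last n))).hasFDerivAt
  have hsum := (hrem.add (hlin.sub hsq)).congr_of_eventuallyEq (f₁ := ρ)
    (Filter.Eventually.of_forall fun z => by simp)
  rw [hsum.fderiv]
  simp

/-- Product rule for the 1-form `dρ ∘ J`. -/
lemma fderiv_theta_apply (n : ℕ) (ρ : (Fin n → ℂ) → ℝ)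
    (J : (Fin n → ℂ) → ((Fin n → ℂ) →L[ℝ] (Fin n → ℂ))) (x u w : Fin n → ℂ)
    (hρ : DifferentiableAt ℝ (fderiv ℝ ρ) x) (hJ : DifferentiableAt ℝ J x) :
    fderiv ℝ (theta n ρ J) x u w =
      fderiv ℝ (fderiv ℝ ρ) x u (J x w) + fderiv ℝ ρ x (fderiv ℝ J x u w) := by
  have h := (hρ.hasFDerivAt.clm_comp hJ.hasFDerivAt).fderiv
  change fderiv ℝ (fun z => (fderiv ℝ ρ z).comp (J z)) x u w = _
  rw [h]
  simp [add_comm]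

/-- if `(J, Γ)` is in standard form at `0`, then the Levi forms of `Γ` at `0`
with respect to `J` and with respect to `J_st` coincide on `D₀ = ℂ^{n−1}×{0}`; in particular
`Γ` is strongly pseudoconvex at `0` for `J` iff it is for `J_st`.  (Ambient space `ℂ^{n+1}`,
greek indices in `Fin n` via `Fin.castSucc`, distinguished index `Fin.last n`.) -/
theorem stmt6 (n : ℕ) (hn : 1 ≤ n)
    (U : Set (Fin (n+1) → ℂ)) (hUopen : IsOpen U) (hU0 : (0 : Fin (n+1) → ℂ) ∈ U)
    (J : (Fin (n+1) → ℂ) → ((Fin (n+1) → ℂ) →L[ℝ] (Fin (n+1) → ℂ)))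
    (hJsmooth : ContDiffOn ℝ (⊤ : ℕ∞) J U)
    (hJacs : ∀ z ∈ U, ∀ v, J z (J z v) = -v)
    (hJ0 : J 0 = Jstd (n+1))
    (L1 L2 : Fin (n+1) → Fin (n+1) → Fin (n+1) → ℂ)
    (hL : ∀ (z v : Fin (n+1) → ℂ) (i : Fin (n+1)),
      fderiv ℝ J 0 z v i =
        ∑ j, ∑ k, (L1 i j k * z k + L2 i j k * conj (z k)) * conj (v j))
    -- standard-form condition (a) on the first-order coefficients:
    (hstd1 : ∀ α β : Fin n, L1 (Fin.last n) α.castSucc β.castSucc = 0)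
    (hstd2 : ∀ α β : Fin n,
      L2 (Fin.last n) α.castSucc β.castSucc = - L2 (Fin.last n) β.castSucc α.castSucc)
    -- standard-form condition (b) on the defining function:
    (ρ : (Fin (n+1) → ℂ) → ℝ) (hρ : ContDiffOn ℝ (⊤ : ℕ∞) ρ U)
    (hρform : (fun z : Fin (n+1) → ℂ =>
        ρ z - (2 * (z (Fin.last n)).re - ∑ α : Fin n, Complex.normSq (z α.castSucc)))
      =O[nhds 0] fun z : Fin (n+1) → ℂ => ‖z‖ ^ 3) :
    (∀ v : Fin (n+1) → ℂ, v (Fin.last n) = 0 →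
      levi (n+1) ρ J 0 v = levi (n+1) ρ (fun _ => Jstd (n+1)) 0 v) ∧
    ((∀ v : Fin (n+1) → ℂ, v ≠ 0 → v (Fin.last n) = 0 → 0 < levi (n+1) ρ J 0 v) ↔
      (∀ v : Fin (n+1) → ℂ, v ≠ 0 → v (Fin.last n) = 0 →
        0 < levi (n+1) ρ (fun _ => Jstd (n+1)) 0 v)) := by
  have hU : U ∈ nhds (0 : Fin (n+1) → ℂ) := hUopen.mem_nhds hU0
  have hJd : DifferentiableAt ℝ J 0 := (hJsmooth.contDiffAt hU).differentiableAt (by simp)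
  have hρd : DifferentiableAt ℝ (fderiv ℝ ρ) 0 :=
    ((hρ.contDiffAt hU).fderiv_right (m := 1) (by norm_cast)).differentiableAt (by simp)
  have key : ∀ v : Fin (n+1) → ℂ, v (Fin.last n) = 0 →
      levi (n+1) ρ J 0 v = levi (n+1) ρ (fun _ => Jstd (n+1)) 0 v := by
    intro v hv
    have htorsion : (fderiv ℝ J 0 v (Jstd (n+1) v) (Fin.last n)) =
        fderiv ℝ J 0 (Jstd (n+1) v) v (Fin.last n) := by
      rw [hL, hL]
      refine Finset.sum_congr rfl fun j _ => Finset.sum_congr rfl fun k _ => ?_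
      rcases Fin.eq_castSucc_or_eq_last j with ⟨α, rfl⟩ | rfl
      · rcases Fin.eq_castSucc_or_eq_last k with ⟨β, rfl⟩ | rfl
        · simp only [hstd1, Jstd, smul_apply, ContinuousLinearMap.id_apply,
            Pi.smul_apply, smul_eq_mul, map_mul, conj_I]
          ring
        · simp [Jstd, hv]
      · simp [Jstd, hv]
    simp only [levi, dtheta, fderiv_theta_apply _ _ _ _ _ _ hρd hJd,
      fderiv_theta_apply _ _ _ _ _ _ hρd (differentiableAt_const _), hJ0,
      fderiv_zero_of_standard_form n ρ hρform, htorsion]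
    simp
  refine ⟨key, forall_congr' fun v => forall_congr' fun _ => forall_congr' fun hv => ?_⟩
  rw [key v hv]
end
end

section
/- Let U be a unitary (n−1)×(n−1) complex matrix and Φ_U : ℂⁿ → ℂⁿ the map Φ_U(z) = (U z′, zⁿ), where z′ = (z¹,…,z^{n−1}). Then Φ_U(Γ⁰) = Γ⁰, and the pushforward of J⁰ under Φ_U, namely w ↦ dΦ_U ∘ J⁰_{Φ_U^{−1}(w)} ∘ dΦ_U^{−1}, is the osculating almost complex structure with coefficients A′_{γ̄δ̄} = Σ_{α,β} U_{γα} U_{δβ} A_{ᾱβ̄} (i.e. A′ = U A Uᵀ), which again satisfy A′_{γ̄δ̄} = −A′_{δ̄γ̄}. -/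
open Complex ComplexConjugate Finset

noncomputable section

/-- The functional `v ↦ Σ_{α,β} A_{ᾱβ̄} z̄^β conj(v^α)` used in the osculating structure. -/
def oscCoeff (n : ℕ) (A : Fin n → Fin n → ℂ) (z : Fin (n+1) → ℂ) :
    (Fin (n+1) → ℂ) →L[ℝ] ℂ :=
  ∑ α : Fin n, ∑ β : Fin n,
    (A α β * conj (z β.castSucc)) •
      (Complex.conjCLE.toContinuousLinearMap.comp
        (ContinuousLinearMap.proj α.castSucc : (Fin (n+1) → ℂ) →L[ℝ] ℂ))

/-- The osculating almost complex structure `J⁰` on `ℂ^{n+1}` with coefficients `A`. -/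
def Josc (n : ℕ) (A : Fin n → Fin n → ℂ) (z : Fin (n+1) → ℂ) :
    (Fin (n+1) → ℂ) →L[ℝ] (Fin (n+1) → ℂ) :=
  Jstd (n+1) + (oscCoeff n A z).smulRight (Pi.single (Fin.last n) 1)

/-- The model hypersurface `Γ⁰ = {2 Re zⁿ − Σ_α |z^α|² = 0}`. -/
def Gamma0 (n : ℕ) : Set (Fin (n+1) → ℂ) :=
  {z | 2 * (z (Fin.last n)).re = ∑ α : Fin n, Complex.normSq (z α.castSucc)}

/-- The map `Φ_U(z) = (U z′, zⁿ)` acting by a matrix `U` on the first `n` coordinates. -/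
def PhiU (n : ℕ) (U : Matrix (Fin n) (Fin n) ℂ) (z : Fin (n+1) → ℂ) :
    Fin (n+1) → ℂ :=
  Fin.snoc (fun γ : Fin n => ∑ β : Fin n, U γ β * z β.castSucc) (z (Fin.last n))

/-- The inverse map `Φ_U⁻¹(w) = (Uᴴ w′, wⁿ)` (for unitary `U`). -/
def PhiUinv (n : ℕ) (U : Matrix (Fin n) (Fin n) ℂ) (w : Fin (n+1) → ℂ) :
    Fin (n+1) → ℂ :=
  Fin.snoc (fun γ : Fin n => ∑ β : Fin n, conj (U β γ) * w β.castSucc) (w (Fin.last n))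

theorem PhiU_last (n : ℕ) (U : Matrix (Fin n) (Fin n) ℂ) (z : Fin (n + 1) → ℂ) :
    PhiU n U z (Fin.last n) = z (Fin.last n) := by
  simp [PhiU]

theorem PhiU_castSucc (n : ℕ) (U : Matrix (Fin n) (Fin n) ℂ) (z : Fin (n + 1) → ℂ)
    (γ : Fin n) :
    PhiU n U z γ.castSucc = ∑ β : Fin n, U γ β * z β.castSucc := by
  simp [PhiU]

theorem PhiU_eq_snoc_mulVec (n : ℕ) (U : Matrix (Fin n) (Fin n) ℂ) (z : Fin (n + 1) → ℂ) :
    PhiU n U z = Fin.snoc (U.mulVec (Fin.init z)) (z (Fin.last n)) := rfl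

theorem PhiUinv_eq_PhiU_star (n : ℕ) (U : Matrix (Fin n) (Fin n) ℂ) (w : Fin (n + 1) → ℂ) :
    PhiUinv n U w = PhiU n (star U) w := rfl

theorem PhiU_PhiU (n : ℕ) (U V : Matrix (Fin n) (Fin n) ℂ) (z : Fin (n + 1) → ℂ) :
    PhiU n U (PhiU n V z) = PhiU n (U * V) z := by
  simp [PhiU_eq_snoc_mulVec, Matrix.mulVec_mulVec]

theorem PhiU_one (n : ℕ) (z : Fin (n + 1) → ℂ) : PhiU n 1 z = z := by
  simp [PhiU_eq_snoc_mulVec]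

theorem sum_normSq_mulVec_of_mem_unitaryGroup {n : ℕ} {U : Matrix (Fin n) (Fin n) ℂ}
    (hU : U ∈ Matrix.unitaryGroup (Fin n) ℂ) (x : Fin n → ℂ) :
    ∑ γ, normSq (U.mulVec x γ) = ∑ γ, normSq (x γ) := by
  have key : ∀ y : Fin n → ℂ, ((∑ γ, normSq (y γ) : ℝ) : ℂ) = star y ⬝ᵥ y := fun y => by
    simp [dotProduct, Complex.normSq_eq_conj_mul_self]
  apply Complex.ofReal_injective
  rw [key, key, Matrix.star_mulVec, ← Matrix.dotProduct_mulVec, Matrix.mulVec_mulVec,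
    ← Matrix.star_eq_conjTranspose, Matrix.mem_unitaryGroup_iff'.mp hU, Matrix.one_mulVec]

theorem PhiU_mem_Gamma0 {n : ℕ} {U : Matrix (Fin n) (Fin n) ℂ}
    (hU : U ∈ Matrix.unitaryGroup (Fin n) ℂ) {z : Fin (n + 1) → ℂ} (hz : z ∈ Gamma0 n) :
    PhiU n U z ∈ Gamma0 n := by
  have h : 2 * (z (Fin.last n)).re = ∑ α : Fin n, normSq (z α.castSucc) := hz
  change 2 * (PhiU n U z (Fin.last n)).re = ∑ α : Fin n, normSq (PhiU n U z α.castSucc)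
  simp only [PhiU_last, PhiU_castSucc, h]
  exact (sum_normSq_mulVec_of_mem_unitaryGroup hU (Fin.init z)).symm

theorem Josc_castSucc (n : ℕ) (A : Fin n → Fin n → ℂ) (z v : Fin (n + 1) → ℂ) (γ : Fin n) :
    Josc n A z v γ.castSucc = I * v γ.castSucc := by
  simp [Josc, Jstd]

theorem oscCoeff_apply (n : ℕ) (A : Fin n → Fin n → ℂ) (z v : Fin (n + 1) → ℂ) :
    oscCoeff n A z v =
      ∑ α : Fin n, ∑ β : Fin n, A α β * conj (z β.castSucc) * conj (v α.castSucc) := by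
  simp [oscCoeff]

theorem Josc_last (n : ℕ) (A : Fin n → Fin n → ℂ) (z v : Fin (n + 1) → ℂ) :
    Josc n A z v (Fin.last n) = I * v (Fin.last n) + oscCoeff n A z v := by
  simp [Josc, Jstd]

theorem oscCoeff_PhiU_star (n : ℕ) (A : Fin n → Fin n → ℂ) (U : Matrix (Fin n) (Fin n) ℂ)
    (w v : Fin (n + 1) → ℂ) :
    oscCoeff n A (PhiU n (star U) w) (PhiU n (star U) v) =
      oscCoeff n (fun γ δ => ∑ α, ∑ β, U γ α * U δ β * A α β) w v := by
  simp only [oscCoeff_apply, PhiU_castSucc, Matrix.star_apply, map_sum, map_mul, RCLike.star_def,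
    Complex.conj_conj, Finset.mul_sum, Finset.sum_mul]
  calc
    _ = ∑ α, ∑ γ, ∑ β, ∑ δ, A α β * (U δ β * conj (w δ.castSucc)) *
          (U γ α * conj (v γ.castSucc)) :=
      Finset.sum_congr rfl fun α _ => Finset.sum_comm
    _ = ∑ γ, ∑ α, ∑ δ, ∑ β, A α β * (U δ β * conj (w δ.castSucc)) *
          (U γ α * conj (v γ.castSucc)) := by
      rw [Finset.sum_comm]
      exact Finset.sum_congr rfl fun γ _ => Finset.sum_congr rfl fun α _ => Finset.sum_comm
    _ = _ := by
      refine Finset.sum_congr rfl fun γ _ => ?_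
      rw [Finset.sum_comm]
      refine Finset.sum_congr rfl fun δ _ => Finset.sum_congr rfl fun α _ =>
        Finset.sum_congr rfl fun β _ => ?_
      ring

theorem PhiU_Josc_castSucc (n : ℕ) (U : Matrix (Fin n) (Fin n) ℂ) (A : Fin n → Fin n → ℂ)
    (z v : Fin (n + 1) → ℂ) (γ : Fin n) :
    PhiU n U (Josc n A z v) γ.castSucc = I * PhiU n U v γ.castSucc := by
  simp only [PhiU_castSucc, Josc_castSucc, Finset.mul_sum]
  exact Finset.sum_congr rfl fun β _ => mul_left_comm _ _ _

/-- a unitary rotation of the first `n` coordinates preserves `Γ⁰` and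
transforms the osculating structure with coefficients `A` into the osculating structure
with coefficients `A′ = U A Uᵀ`, which are again antisymmetric. -/
theorem stmt14 (n : ℕ) (hn : 1 ≤ n) (A : Fin n → Fin n → ℂ)
    (hA : ∀ α β, A α β = - A β α)
    (U : Matrix (Fin n) (Fin n) ℂ) (hU : U ∈ Matrix.unitaryGroup (Fin n) ℂ)
    (A' : Fin n → Fin n → ℂ)
    (hA' : ∀ γ δ, A' γ δ = ∑ α : Fin n, ∑ β : Fin n, U γ α * U δ β * A α β) :
    (PhiU n U '' Gamma0 n = Gamma0 n) ∧
    (∀ w v : Fin (n+1) → ℂ,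
      PhiU n U (Josc n A (PhiUinv n U w) (PhiUinv n U v)) = Josc n A' w v) ∧
    (∀ γ δ, A' γ δ = - A' δ γ) := by
  have hUstar : star U ∈ Matrix.unitaryGroup (Fin n) ℂ := Unitary.star_mem hU
  have hinv : ∀ w, PhiU n U (PhiU n (star U) w) = w := fun w => by
    rw [PhiU_PhiU, Matrix.mem_unitaryGroup_iff.mp hU, PhiU_one]
  obtain rfl : A' = fun γ δ => ∑ α, ∑ β, U γ α * U δ β * A α β :=
    funext fun γ => funext fun δ => hA' γ δ
  refine ⟨?_, fun w v => ?_, fun γ δ => ?_⟩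
  · refine Set.Subset.antisymm ?_ fun w hw =>
      ⟨PhiU n (star U) w, PhiU_mem_Gamma0 hUstar hw, hinv w⟩
    rintro _ ⟨z, hz, rfl⟩
    exact PhiU_mem_Gamma0 hU hz
  · simp only [PhiUinv_eq_PhiU_star]
    funext j
    refine Fin.lastCases ?_ (fun γ => ?_) j
    · rw [PhiU_last, Josc_last, Josc_last, PhiU_last, oscCoeff_PhiU_star]
    · rw [PhiU_Josc_castSucc, hinv, Josc_castSucc]
  · simp only [← Finset.sum_neg_distrib]
    rw [Finset.sum_comm]
    refine Finset.sum_congr rfl fun β _ => Finset.sum_congr rfl fun α _ => ?_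
    rw [hA α β]
    ring
end
end
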